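/- For all t in the open interval (1, 2^{1/6}), the polynomial g_{α₀}(t) = α₀²t⁶ + 2α₀²t⁵ + 3(-α₀² + 4α₀ - 2)t⁴ + 2(-2α₀² + 9α₀ - 6)t³ + (4α₀² + 6α₀ - 9)t² - 6(1-α₀)t - 3(1-α₀) is strictly increasing in t, where α₀ = (3 - 3·2^{1/6}·log(1+√2)) / ((2 + √2 - 3·2^{1/6})·log(1+√2)). -/

import Mathlib

noncomputable def α₀ : ℝ :=
  (3 - 3 * (2 : ℝ) ^ ((1 : ℝ)/6) * Real.log (1 + Real.sqrt 2)) /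
    ((2 + Real.sqrt 2 - 3 * (2 : ℝ) ^ ((1 : ℝ)/6)) * Real.log (1 + Real.sqrt 2))

lemma log_one_add_sqrt_two_lt : Real.log (1 + √2) < 0.882 := by
  rw [Real.log_lt_iff_lt_exp (by positivity)]
  have h := Real.sum_le_exp_of_nonneg (show (0 : ℝ) ≤ 0.882 by norm_num) 7
  have h2 : √2 < 1.41422 := (Real.sqrt_lt' (by norm_num)).2 (by norm_num)
  norm_num [Finset.sum_range_succ, Nat.factorial] at h h2 ⊢
  linarith

lemma two_rpow_one_sixth_lt : (2 : ℝ) ^ ((1 : ℝ) / 6) < 1.12247 := by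
  refine lt_of_pow_lt_pow_left₀ 6 (by norm_num) ?_
  rw [← Real.rpow_natCast, ← Real.rpow_mul (by norm_num)]
  norm_num

lemma seven_tenths_lt_α₀ : 7 / 10 < α₀ := by
  have hL := log_one_add_sqrt_two_lt
  have hc := two_rpow_one_sixth_lt
  have hs : √2 < 1.41422 := (Real.sqrt_lt' (by norm_num)).2 (by norm_num)
  have hs' : 1.414 < √2 := (Real.lt_sqrt (by norm_num)).2 (by norm_num)
  have hL0 : 0 < Real.log (1 + √2) := Real.log_pos (by linarith)
  unfold α₀
  generalize Real.log (1 + √2) = L at *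
  generalize (2 : ℝ) ^ ((1 : ℝ) / 6) = c at *
  generalize √2 = s at *
  rw [lt_div_iff₀ (mul_pos (by linarith) hL0)]
  have h : L * (0.9 * c + 1.4 + 0.7 * s) ≤ L * 3.40018 :=
    mul_le_mul_of_nonneg_left (by linarith) hL0.le
  linarith

lemma strictMonoOn_of_seven_tenths_lt {a : ℝ} (ha : 7 / 10 < a) :
    StrictMonoOn (fun t : ℝ =>
      a ^ 2 * t ^ 6 + 2 * a ^ 2 * t ^ 5 + 3 * (-a ^ 2 + 4 * a - 2) * t ^ 4 +
        2 * (-2 * a ^ 2 + 9 * a - 6) * t ^ 3 + (4 * a ^ 2 + 6 * a - 9) * t ^ 2 -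
        6 * (1 - a) * t - 3 * (1 - a)) (Set.Ici 1) := by
  have h1 : 0 < 120 * a - 84 := by linarith
  have h2 : 0 < 18 * a ^ 2 + 264 * a - 162 := by nlinarith
  have h3 : 0 < 72 * a ^ 2 + 198 * a - 108 := by nlinarith
  have h4 : 0 < 88 * a ^ 2 + 48 * a - 24 := by nlinarith
  intro x hx y hy hxy
  obtain ⟨u, rfl⟩ : ∃ u, x = 1 + u := ⟨x - 1, by ring⟩
  obtain ⟨v, rfl⟩ : ∃ v, y = 1 + v := ⟨y - 1, by ring⟩
  have hu : 0 ≤ u := by simpa using hx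
  have huv : u < v := by simpa using hxy
  have k1 : 0 < (120 * a - 84) * (v - u) := mul_pos h1 (by linarith)
  have k (n : ℕ) {b : ℝ} (hb : 0 ≤ b) : 0 ≤ b * (v ^ n - u ^ n) :=
    mul_nonneg hb (sub_nonneg.2 (pow_le_pow_left₀ hu huv.le n))
  have k2 := k 2 h2.le
  have k3 := k 3 h3.le
  have k4 := k 4 h4.le
  have k5 := k 5 (sq_nonneg a)
  have k6 := k 6 (sq_nonneg a)
  rw [← sub_pos]
  linarith

theorem stmt_12 :
    StrictMonoOn (fun t : ℝ =>
      α₀ ^ 2 * t ^ 6 + 2 * α₀ ^ 2 * t ^ 5 + 3 * (-α₀ ^ 2 + 4 * α₀ - 2) * t ^ 4 +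
        2 * (-2 * α₀ ^ 2 + 9 * α₀ - 6) * t ^ 3 + (4 * α₀ ^ 2 + 6 * α₀ - 9) * t ^ 2 -
        6 * (1 - α₀) * t - 3 * (1 - α₀))
      (Set.Ioo 1 ((2 : ℝ) ^ ((1 : ℝ)/6))) :=
  (strictMonoOn_of_seven_tenths_lt seven_tenths_lt_α₀).mono fun _ ht => ht.1.le
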